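/- arXiv:1905.08469 — 3 statements merged into one kernel-verified Lean document; each statement's English description precedes it below -/
import Mathlib

section
/- Let ρ be a Hermitian d×d complex matrix and let G : ι×ι → ℂ satisfy G_{nn} = 1 for all n. Then the partially dephased matrix 𝒢_G(ρ) = Σ_{n,m} G_{nm} P_n ρ P_m satisfies ‖𝒢_G(ρ) − 𝒟(ρ)‖₂ ≤ (max_{n≠m} |G_{nm}|) · ‖ρ − 𝒟(ρ)‖₂ (here ι has at least two elements so the maximum is over a nonempty set). -/
open Matrix BigOperators

/-- The Frobenius (Hilbert–Schmidt) norm `‖X‖₂ = √(tr(XᴴX))`. -/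
noncomputable def frob {d : ℕ} (X : Matrix (Fin d) (Fin d) ℂ) : ℝ :=
  Real.sqrt ((Xᴴ * X).trace.re)

/-- The dephasing map `𝒟(X) = Σ_n P_n X P_n`. -/
noncomputable def deph {d : ℕ} {ι : Type*} [Fintype ι]
    (P : ι → Matrix (Fin d) (Fin d) ℂ) (X : Matrix (Fin d) (Fin d) ℂ) :
    Matrix (Fin d) (Fin d) ℂ :=
  ∑ n, P n * X * P n

/-- The partial dephasing map `𝒢_G(X) = Σ_{n,m} G_{nm} P_n X P_m`. -/
noncomputable def pdeph {d : ℕ} {ι : Type*} [Fintype ι]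
    (P : ι → Matrix (Fin d) (Fin d) ℂ) (G : ι → ι → ℂ)
    (X : Matrix (Fin d) (Fin d) ℂ) : Matrix (Fin d) (Fin d) ℂ :=
  ∑ n, ∑ m, G n m • (P n * X * P m)

/-- `max_{n≠m} |G_{nm}|`, the maximum modulus of the off-diagonal coefficients. -/
noncomputable def maxOffDiag {ι : Type*} [Fintype ι] [DecidableEq ι] [Nontrivial ι]
    (G : ι → ι → ℂ) : ℝ :=
  Finset.univ.offDiag.sup'
    (by
      obtain ⟨a, b, hab⟩ := exists_pair_ne ι
      exact ⟨(a, b), Finset.mem_offDiag.mpr ⟨Finset.mem_univ _, Finset.mem_univ _, hab⟩⟩)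
    (fun p => ‖G p.1 p.2‖)

open scoped ComplexOrder in
lemma frob_sq {d : ℕ} (X : Matrix (Fin d) (Fin d) ℂ) :
    frob X ^ 2 = (Xᴴ * X).trace.re := by
  have h := (Complex.le_def.mp (posSemidef_conjTranspose_mul_self X).trace_nonneg).1
  exact Real.sq_sqrt h

lemma frob_nonneg {d : ℕ} (X : Matrix (Fin d) (Fin d) ℂ) : 0 ≤ frob X :=
  Real.sqrt_nonneg _

lemma frob_zero {d : ℕ} : frob (0 : Matrix (Fin d) (Fin d) ℂ) = 0 := by
  simp [frob]

lemma frob_smul_sq {d : ℕ} (c : ℂ) (X : Matrix (Fin d) (Fin d) ℂ) :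
    frob (c • X) ^ 2 = ‖c‖ ^ 2 * frob X ^ 2 := by
  rw [frob_sq, frob_sq, conjTranspose_smul, smul_mul_smul_comm, trace_smul, smul_eq_mul,
    Complex.star_def, ← Complex.normSq_eq_conj_mul_self, Complex.re_ofReal_mul,
    Complex.normSq_eq_norm_sq]

/-- Pythagoras for the block decomposition with respect to a resolution of the identity. -/
lemma frob_sq_eq_sum_blocks {d : ℕ} {ι : Type*} [Fintype ι]
    (P : ι → Matrix (Fin d) (Fin d) ℂ) (hHerm : ∀ n, (P n)ᴴ = P n)
    (hIdem : ∀ n, P n * P n = P n) (hSum : ∑ n, P n = 1)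
    (X : Matrix (Fin d) (Fin d) ℂ) :
    frob X ^ 2 = ∑ n, ∑ m, frob (P n * X * P m) ^ 2 := by
  have block (n m : ι) : ((P n * X * P m)ᴴ * (P n * X * P m)).trace =
      (Xᴴ * P n * X * P m).trace := by
    calc ((P n * X * P m)ᴴ * (P n * X * P m)).trace
        = (P m * (Xᴴ * (P n * P n) * X * P m)).trace := by
          simp only [conjTranspose_mul, hHerm, Matrix.mul_assoc]
      _ = (Xᴴ * P n * X * (P m * P m)).trace := by
          rw [trace_mul_comm, hIdem, Matrix.mul_assoc _ (P m) (P m)]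
      _ = (Xᴴ * P n * X * P m).trace := by rw [hIdem]
  simp only [frob_sq, block, ← Complex.re_sum, ← trace_sum, ← Finset.mul_sum, hSum,
    Matrix.mul_one, ← Finset.sum_mul]

lemma block_pdeph {d : ℕ} {ι : Type*} [Fintype ι]
    (P : ι → Matrix (Fin d) (Fin d) ℂ)
    (hOrth : ∀ n m, n ≠ m → P n * P m = 0) (hIdem : ∀ n, P n * P n = P n)
    (G : ι → ι → ℂ) (X : Matrix (Fin d) (Fin d) ℂ) (n m : ι) :
    P n * pdeph P G X * P m = G n m • (P n * X * P m) := by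
  have term (a b : ι) : P n * (G a b • (P a * X * P b)) * P m =
      G a b • (P n * P a * X * (P b * P m)) := by
    simp only [Matrix.mul_smul, Matrix.smul_mul, Matrix.mul_assoc]
  simp only [pdeph, Finset.mul_sum, Finset.sum_mul, term]
  rw [Finset.sum_eq_single n, Finset.sum_eq_single m, hIdem, hIdem]
  · intro b _ hb
    simp [hOrth b m hb]
  · simp
  · intro a _ ha
    simp [hOrth n a ha.symm]
  · simp

lemma deph_eq_pdeph {d : ℕ} {ι : Type*} [Fintype ι] [DecidableEq ι]
    (P : ι → Matrix (Fin d) (Fin d) ℂ) (X : Matrix (Fin d) (Fin d) ℂ) :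
    deph P X = pdeph P (fun n m => if n = m then 1 else 0) X := by
  simp [deph, pdeph, ite_smul]

lemma norm_le_maxOffDiag {ι : Type*} [Fintype ι] [DecidableEq ι] [Nontrivial ι]
    (G : ι → ι → ℂ) {n m : ι} (h : n ≠ m) : ‖G n m‖ ≤ maxOffDiag G :=
  Finset.le_sup' (b := (n, m)) (fun p : ι × ι => ‖G p.1 p.2‖)
    (Finset.mem_offDiag.mpr ⟨Finset.mem_univ n, Finset.mem_univ m, h⟩)

lemma maxOffDiag_nonneg {ι : Type*} [Fintype ι] [DecidableEq ι] [Nontrivial ι]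
    (G : ι → ι → ℂ) : 0 ≤ maxOffDiag G := by
  obtain ⟨a, b, hab⟩ := exists_pair_ne ι
  exact (norm_nonneg _).trans (norm_le_maxOffDiag G hab)

/-- for Hermitian `ρ` and coefficients `G` with unit diagonal,
`‖𝒢_G(ρ) − 𝒟(ρ)‖₂ ≤ (max_{n≠m} |G_{nm}|) ‖ρ − 𝒟(ρ)‖₂`. -/
theorem pdeph_sub_deph_le {d : ℕ} {ι : Type*} [Fintype ι] [DecidableEq ι] [Nontrivial ι]
    (P : ι → Matrix (Fin d) (Fin d) ℂ)
    (hHerm : ∀ n, (P n)ᴴ = P n)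
    (hOrth : ∀ n m, n ≠ m → P n * P m = 0)
    (hIdem : ∀ n, P n * P n = P n)
    (hSum : ∑ n, P n = 1)
    (ρ : Matrix (Fin d) (Fin d) ℂ) (hρ : ρᴴ = ρ)
    (G : ι → ι → ℂ) (hG : ∀ n, G n n = 1) :
    frob (pdeph P G ρ - deph P ρ) ≤ maxOffDiag G * frob (ρ - deph P ρ) := by
  refine (sq_le_sq₀ (frob_nonneg _) (mul_nonneg (maxOffDiag_nonneg G) (frob_nonneg _))).mp ?_
  rw [mul_pow, frob_sq_eq_sum_blocks P hHerm hIdem hSum (pdeph P G ρ - deph P ρ),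
    frob_sq_eq_sum_blocks P hHerm hIdem hSum (ρ - deph P ρ)]
  simp only [Finset.mul_sum]
  refine Finset.sum_le_sum fun n _ => Finset.sum_le_sum fun m _ => ?_
  simp only [Matrix.mul_sub, Matrix.sub_mul, deph_eq_pdeph, block_pdeph P hOrth hIdem]
  by_cases h : n = m
  · subst h
    simp [hG, frob_zero]
  · simp only [h, if_false, zero_smul, sub_zero, frob_smul_sq]
    gcongr
    exact norm_le_maxOffDiag G h
end

section
/- Let ρ be a d×d density matrix (positive semidefinite with trace 1). Then ‖ρ − 𝒟(ρ)‖₂² ≤ 1 − 1/d. -/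
open Matrix BigOperators
open scoped ComplexOrder

/-- `X - 𝒟(X)` is trace-orthogonal to `𝒟(X)`. -/
theorem trace_deph_mul_deph {d : ℕ} {ι : Type*} [Fintype ι] [DecidableEq ι]
    (P : ι → Matrix (Fin d) (Fin d) ℂ)
    (hOrth : ∀ n m, n ≠ m → P n * P m = 0) (hIdem : ∀ n, P n * P n = P n)
    (X : Matrix (Fin d) (Fin d) ℂ) :
    (deph P X * deph P X).trace = (X * deph P X).trace := by
  have hmul (n : ι) : P n * deph P X = P n * X * P n := by
    rw [deph, Finset.mul_sum, Finset.sum_eq_single n]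
    · rw [← Matrix.mul_assoc, ← Matrix.mul_assoc, hIdem]
    · intro m _ hm
      rw [← Matrix.mul_assoc, ← Matrix.mul_assoc, hOrth n m hm.symm, Matrix.zero_mul,
        Matrix.zero_mul]
    · simp
  have hleft : deph P X * deph P X = ∑ n, P n * (X * (P n * X * P n)) := by
    nth_rw 1 [deph]
    rw [Finset.sum_mul]
    refine Finset.sum_congr rfl fun n _ => ?_
    rw [Matrix.mul_assoc, hmul, Matrix.mul_assoc]
  rw [hleft, deph, Finset.mul_sum, Matrix.trace_sum, Matrix.trace_sum]
  refine Finset.sum_congr rfl fun n _ => ?_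
  rw [Matrix.trace_mul_comm]
  simp only [Matrix.mul_assoc, hIdem]

/-- Dephasing preserves the trace. -/
theorem trace_deph {d : ℕ} {ι : Type*} [Fintype ι]
    (P : ι → Matrix (Fin d) (Fin d) ℂ) (hIdem : ∀ n, P n * P n = P n) (hSum : ∑ n, P n = 1)
    (X : Matrix (Fin d) (Fin d) ℂ) : (deph P X).trace = X.trace := by
  have h (n : ι) : (P n * X * P n).trace = (P n * X).trace := by
    rw [Matrix.trace_mul_comm, ← Matrix.mul_assoc, hIdem]
  rw [deph, Matrix.trace_sum, Finset.sum_congr rfl fun n _ => h n, ← Matrix.trace_sum,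
    ← Finset.sum_mul, hSum, Matrix.one_mul]

/-- Dephasing preserves Hermitian matrices. -/
theorem conjTranspose_deph {d : ℕ} {ι : Type*} [Fintype ι]
    (P : ι → Matrix (Fin d) (Fin d) ℂ) (hHerm : ∀ n, (P n)ᴴ = P n)
    {X : Matrix (Fin d) (Fin d) ℂ} (hX : Xᴴ = X) : (deph P X)ᴴ = deph P X := by
  simp only [deph, Matrix.conjTranspose_sum, Matrix.conjTranspose_mul, hHerm, hX,
    Matrix.mul_assoc]

theorem trace_conjTranspose_mul_self_re_nonneg {d : ℕ} (X : Matrix (Fin d) (Fin d) ℂ) :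
    0 ≤ (Xᴴ * X).trace.re :=
  (Complex.le_def.1 (Matrix.posSemidef_conjTranspose_mul_self X).trace_nonneg).1

open scoped MatrixOrder in
theorem Matrix.PosSemidef.exists_eq_conjTranspose_mul_self {d : ℕ}
    {A : Matrix (Fin d) (Fin d) ℂ} (hA : A.PosSemidef) :
    ∃ B : Matrix (Fin d) (Fin d) ℂ, A = Bᴴ * B :=
  CStarAlgebra.nonneg_iff_eq_star_mul_self.mp hA.nonneg

section

attribute [local instance] Matrix.frobeniusNormedRing

theorem trace_conjTranspose_mul_self_re_eq_norm_sq {d : ℕ} (X : Matrix (Fin d) (Fin d) ℂ) :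
    (Xᴴ * X).trace.re = ‖X‖ ^ 2 := by
  rw [Matrix.frobenius_norm_def, ← Real.sqrt_eq_rpow, Real.sq_sqrt (by positivity),
    Finset.sum_comm]
  simp [Matrix.trace, Matrix.mul_apply, Complex.sq_norm, Complex.normSq_apply]

/-- The purity of a positive semidefinite matrix is at most its squared trace. -/
theorem Matrix.PosSemidef.trace_mul_self_re_le {d : ℕ} {A : Matrix (Fin d) (Fin d) ℂ}
    (hA : A.PosSemidef) : (A * A).trace.re ≤ A.trace.re ^ 2 := by
  obtain ⟨B, rfl⟩ := hA.exists_eq_conjTranspose_mul_self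
  have h := trace_conjTranspose_mul_self_re_eq_norm_sq (Bᴴ * B)
  rw [(Matrix.isHermitian_conjTranspose_mul_self B).eq] at h
  rw [h, trace_conjTranspose_mul_self_re_eq_norm_sq]
  gcongr
  calc ‖Bᴴ * B‖ ≤ ‖Bᴴ‖ * ‖B‖ := norm_mul_le _ _
    _ = ‖B‖ ^ 2 := by rw [Matrix.frobenius_norm_conjTranspose, sq]

end

/-- for a density matrix `ρ` (positive semidefinite, trace 1) on a
`d`-dimensional space (`d ≥ 1`), `‖ρ − 𝒟(ρ)‖₂² ≤ 1 − 1/d`. -/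
theorem frob_sub_deph_sq_le {d : ℕ} (hd : 0 < d) {ι : Type*} [Fintype ι] [DecidableEq ι]
    (P : ι → Matrix (Fin d) (Fin d) ℂ)
    (hHerm : ∀ n, (P n)ᴴ = P n)
    (hOrth : ∀ n m, n ≠ m → P n * P m = 0)
    (hIdem : ∀ n, P n * P n = P n)
    (hSum : ∑ n, P n = 1)
    (ρ : Matrix (Fin d) (Fin d) ℂ)
    (hρ : ρ.PosSemidef) (htr : ρ.trace = 1) :
    (frob (ρ - deph P ρ)) ^ 2 ≤ 1 - 1 / (d : ℝ) := by
  set D := deph P ρ with hD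
  have hDherm : Dᴴ = D := conjTranspose_deph P hHerm hρ.isHermitian
  have hDD : (D * D).trace = (ρ * D).trace := trace_deph_mul_deph P hOrth hIdem ρ
  have hDtr : D.trace = 1 := (trace_deph P hIdem hSum ρ).trans htr
  have hpyth : ((ρ - D)ᴴ * (ρ - D)).trace.re = (ρ * ρ).trace.re - (D * D).trace.re := by
    rw [Matrix.conjTranspose_sub, hρ.isHermitian.eq, hDherm, Matrix.sub_mul, Matrix.mul_sub,
      Matrix.mul_sub, Matrix.trace_sub, Matrix.trace_sub, Matrix.trace_sub,
      Matrix.trace_mul_comm D ρ, hDD]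
    simp
  have hpurity : (ρ * ρ).trace.re ≤ 1 := by
    simpa [htr] using hρ.trace_mul_self_re_le
  have hd' : (d : ℝ) ≠ 0 := by positivity
  have hmixed : 1 / (d : ℝ) ≤ (D * D).trace.re := by
    have h := trace_conjTranspose_mul_self_re_nonneg (D - ((1 / (d : ℝ) : ℝ) : ℂ) • 1)
    have hexp : ((D - ((1 / (d : ℝ) : ℝ) : ℂ) • (1 : Matrix (Fin d) (Fin d) ℂ))ᴴ *
        (D - ((1 / (d : ℝ) : ℝ) : ℂ) • 1)).trace =
        (D * D).trace - ((1 / (d : ℝ) : ℝ) : ℂ) := by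
      rw [Matrix.conjTranspose_sub, hDherm, Matrix.conjTranspose_smul,
        Matrix.conjTranspose_one, Complex.star_def, Complex.conj_ofReal, Matrix.sub_mul,
        Matrix.mul_sub, Matrix.mul_sub]
      have hd'' : (d : ℂ) ≠ 0 := by exact_mod_cast hd'
      simp [hDtr, hd'']
    rw [hexp, Complex.sub_re, Complex.ofReal_re] at h
    linarith
  rw [frob, Real.sq_sqrt (trace_conjTranspose_mul_self_re_nonneg _), hpyth]
  linarith
end

section
/- Let 𝒜₀, …, 𝒜_k and 𝒢₀, …, 𝒢_k and 𝒟₀, …, 𝒟_k be arbitrary linear maps on M_d. Writing 𝒜_{b:a} = 𝒜_b ∘ ⋯ ∘ 𝒜_a, 𝒢_{b:a} = 𝒢_b ∘ ⋯ ∘ 𝒢_a, 𝒟_{b:a} = 𝒟_b ∘ ⋯ ∘ 𝒟_a, the following exact operator identity holds: (𝒜_k∘𝒢_k) ∘ ⋯ ∘ (𝒜₀∘𝒢₀) − (𝒜_k∘𝒟_k) ∘ ⋯ ∘ (𝒜₀∘𝒟₀) = 𝒜_{k:0} ∘ (𝒢_{k:0} − 𝒟_{k:0}) + Σ_{ℓ=0}^{k−1}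 𝒜_{k:ℓ+1} ∘ ( [𝒢_{k:ℓ+1}, 𝒜_ℓ] ∘ 𝒢_ℓ ∘ (𝒜_{ℓ−1}∘𝒢_{ℓ−1}) ∘ ⋯ ∘ (𝒜₀∘𝒢₀) − [𝒟_{k:ℓ+1}, 𝒜_ℓ] ∘ 𝒟_ℓ ∘ (𝒜_{ℓ−1}∘𝒟_{ℓ−1}) ∘ ⋯ ∘ (𝒜₀∘𝒟₀) ), where [𝒳, 𝒴] = 𝒳∘𝒴 − 𝒴∘𝒳 denotes the commutator of linear maps. -/
open Matrix BigOperators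

/-- `chainEnd f a n = f (a+n−1) ∘ ⋯ ∘ f (a+1) ∘ f a` as an element of the endomorphism
ring (the identity map when `n = 0`); composition of linear maps is `*`. -/
noncomputable def chainEnd {d : ℕ}
    (f : ℕ → Module.End ℂ (Matrix (Fin d) (Fin d) ℂ)) (a n : ℕ) :
    Module.End ℂ (Matrix (Fin d) (Fin d) ℂ) :=
  (((List.range' a n).reverse).map f).prod

section ChainEnd

variable {d : ℕ} (f A G : ℕ → Module.End ℂ (Matrix (Fin d) (Fin d) ℂ))

theorem chainEnd_zero (a : ℕ) : chainEnd f a 0 = 1 := by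
  simp [chainEnd]

theorem chainEnd_succ_right (a n : ℕ) :
    chainEnd f a (n + 1) = chainEnd f (a + 1) n * f a := by
  simp [chainEnd, List.range'_succ]

theorem chainEnd_succ_left (a n : ℕ) :
    chainEnd f a (n + 1) = f (a + n) * chainEnd f a n := by
  simp [chainEnd, List.range'_concat]

/-- Commuting the `A` factors to the left, one at a time, through an alternating product. -/
theorem chainEnd_mul_eq_add_sum (k : ℕ) :
    chainEnd (fun j => A j * G j) 0 (k + 1) =
      chainEnd A 0 (k + 1) * chainEnd G 0 (k + 1) +
        ∑ ℓ ∈ Finset.range k, chainEnd A (ℓ + 1) (k - ℓ) *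
          ((chainEnd G (ℓ + 1) (k - ℓ) * A ℓ - A ℓ * chainEnd G (ℓ + 1) (k - ℓ)) *
            G ℓ * chainEnd (fun j => A j * G j) 0 ℓ) := by
  set P := chainEnd (fun j => A j * G j) 0 with hP
  let T : ℕ → Module.End ℂ (Matrix (Fin d) (Fin d) ℂ) := fun ℓ =>
    chainEnd A ℓ (k + 1 - ℓ) * chainEnd G ℓ (k + 1 - ℓ) * P ℓ
  have hT : ∀ ℓ ∈ Finset.range k, chainEnd A (ℓ + 1) (k - ℓ) *
      ((chainEnd G (ℓ + 1) (k - ℓ) * A ℓ - A ℓ * chainEnd G (ℓ + 1) (k - ℓ)) *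
        G ℓ * P ℓ) = T (ℓ + 1) - T ℓ := by
    intro ℓ hℓ
    have hℓk : k + 1 - ℓ = k - ℓ + 1 := by
      have := Finset.mem_range.mp hℓ
      omega
    have hPs : P (ℓ + 1) = A ℓ * G ℓ * P ℓ := by
      simp [hP, chainEnd_succ_left]
    simp only [T, hℓk, Nat.add_sub_add_right, chainEnd_succ_right, hPs]
    simp only [sub_mul, mul_sub, mul_assoc]
  have hTk : T k = P (k + 1) := by
    simp [T, hP, chainEnd_succ_left, chainEnd_zero]
  have hT0 : T 0 = chainEnd A 0 (k + 1) * chainEnd G 0 (k + 1) := by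
    simp [T, hP, chainEnd_zero]
  rw [Finset.sum_congr rfl hT, Finset.sum_range_sub, hTk, hT0, add_sub_cancel]

end ChainEnd

/-- for arbitrary linear maps `𝒜₀,…,𝒜_k`, `𝒢₀,…,𝒢_k`, `𝒟₀,…,𝒟_k` on `M_d`,
`(𝒜_k𝒢_k)⋯(𝒜₀𝒢₀) − (𝒜_k𝒟_k)⋯(𝒜₀𝒟₀) = 𝒜_{k:0}(𝒢_{k:0} − 𝒟_{k:0}) +
Σ_{ℓ=0}^{k−1} 𝒜_{k:ℓ+1}([𝒢_{k:ℓ+1},𝒜_ℓ]𝒢_ℓ(𝒜_{ℓ−1}𝒢_{ℓ−1})⋯(𝒜₀𝒢₀)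
 − [𝒟_{k:ℓ+1},𝒜_ℓ]𝒟_ℓ(𝒜_{ℓ−1}𝒟_{ℓ−1})⋯(𝒜₀𝒟₀))`,
with `[𝒳,𝒴] = 𝒳∘𝒴 − 𝒴∘𝒳`. -/
theorem telescoping_operator_identity {d : ℕ} (k : ℕ)
    (A G D : ℕ → Module.End ℂ (Matrix (Fin d) (Fin d) ℂ)) :
    chainEnd (fun j => A j * G j) 0 (k + 1) - chainEnd (fun j => A j * D j) 0 (k + 1) =
      chainEnd A 0 (k + 1) * (chainEnd G 0 (k + 1) - chainEnd D 0 (k + 1)) +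
        ∑ ℓ ∈ Finset.range k,
          chainEnd A (ℓ + 1) (k - ℓ) *
            ((chainEnd G (ℓ + 1) (k - ℓ) * A ℓ - A ℓ * chainEnd G (ℓ + 1) (k - ℓ)) *
                G ℓ * chainEnd (fun j => A j * G j) 0 ℓ -
              (chainEnd D (ℓ + 1) (k - ℓ) * A ℓ - A ℓ * chainEnd D (ℓ + 1) (k - ℓ)) *
                D ℓ * chainEnd (fun j => A j * D j) 0 ℓ) := by
  simp only [mul_sub, Finset.sum_sub_distrib]
  rw [chainEnd_mul_eq_add_sum A G, chainEnd_mul_eq_add_sum A D]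
  abel
end
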